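/- arXiv:1110.6881 — 3 statements merged into one kernel-verified Lean document; each statement's English description precedes it below -/
import Mathlib

section
/- Let p be a prime. Then f ≡ x^p modulo the ideal p·ℤ[x], i.e., every coefficient of the polynomial f − x^p is divisible by p. -/
open Polynomial

/-- The polynomials `m n ∈ ℤ[x]` defined by `m 0 = 1`, `m 1 = X`,
`m n = X * m (n-1) - m (n-2)` for `n ≥ 2` (note `m 2 = X^2 - 1`). -/
noncomputable def m : ℕ → Polynomial ℤ
  | 0 => 1
  | 1 => X
  | (n + 2) => X * m (n + 1) - m n

theorem m_sub_eq_dickson : ∀ n : ℕ, m (n + 2) - m n = dickson 1 (1 : ℤ) (n + 2)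
  | 0 => by
    simp only [m, zero_add, dickson_two]
    norm_num
    ring
  | 1 => by
    rw [dickson_add_two, dickson_two, dickson_one]
    simp only [m]
    norm_num
    ring
  | (n + 2) => by
    rw [dickson_add_two, ← m_sub_eq_dickson n, ← m_sub_eq_dickson (n + 1)]
    have h1 : m (n + 2 + 2) = X * m (n + 1 + 2) - m (n + 2) := by rw [m]
    have h2 : m (n + 2) = X * m (n + 1) - m n := by rw [m]
    rw [h1, C_1]
    linear_combination -h2

/-- For `p` prime and `f = m p - m (p-2)`, one has `f ≡ x^p (mod p ℤ[x])`:
every coefficient of `f - x^p` is divisible by `p`. -/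
theorem stmt_4 (p : ℕ) (hp : p.Prime) :
    ∀ k : ℕ, (p : ℤ) ∣ (m p - m (p - 2) - X ^ p).coeff k := by
  intro k
  haveI : Fact p.Prime := ⟨hp⟩
  obtain ⟨n, rfl⟩ : ∃ n, p = n + 2 := ⟨p - 2, by have := hp.two_le; omega⟩
  rw [Nat.add_sub_cancel, m_sub_eq_dickson, ← ZMod.intCast_zmod_eq_zero_iff_dvd]
  have h : ((dickson 1 (1 : ℤ) (n + 2) - X ^ (n + 2)).map (Int.castRingHom (ZMod (n + 2)))) = 0 := by
    rw [Polynomial.map_sub, map_dickson, map_one, dickson_one_one_zmod_p]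
    simp
  have h3 := congrArg (fun q => q.coeff k) h
  simpa only [coeff_map, eq_intCast, coeff_zero] using h3
end

section
/- Let p be a prime and j an integer with 1 ≤ j ≤ ⌊p/2⌋. Then p divides C(p−j, j) + C(p−j−1, j−1), where C(a,b) denotes the binomial coefficient. -/
/-- For `p` prime and `1 ≤ j ≤ ⌊p/2⌋`, `p` divides `C(p-j, j) + C(p-j-1, j-1)`. -/
theorem stmt_5 (p : ℕ) (hp : p.Prime) (j : ℕ) (h1 : 1 ≤ j) (h2 : j ≤ p / 2) :
    p ∣ (p - j).choose j + (p - j - 1).choose (j - 1) := by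
  have hp2 := hp.two_le
  obtain ⟨k, rfl⟩ : ∃ k, j = k + 1 := ⟨j - 1, by omega⟩
  obtain ⟨n, hn⟩ : ∃ n, p = n + 1 + (k + 1) := ⟨p - (k + 1) - 1, by omega⟩
  have e1 : p - (k + 1) = n + 1 := by omega
  rw [e1, Nat.add_sub_cancel, Nat.add_sub_cancel]
  have hcop : Nat.Coprime p (k + 1) :=
    hp.coprime_iff_not_dvd.2 fun hd => by
      have := Nat.le_of_dvd (Nat.succ_pos k) hd
      omega
  refine hcop.dvd_of_dvd_mul_right ⟨n.choose k, ?_⟩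
  have h := Nat.add_one_mul_choose_eq n k
  rw [add_mul, ← h, hn]
  ring
end

section
/- Let p be a prime with p > 3 and let f = m_p − m_{p−2}. Then the integers 0, 1, −1, 2, −2 are all roots of the polynomial f(x) − x, i.e., f(0) = 0, f(1) = 1, f(−1) = −1, f(2) = 2, and f(−2) = −2. Moreover, for p = 3 the integers 0, 2, −2 are roots of f(x) − x. -/
open Polynomial

theorem m_rec (n : ℕ) (x : ℤ) : (m (n + 2)).eval x = x * (m (n + 1)).eval x - (m n).eval x := by
  simp [m]

theorem m_zero_eval (x : ℤ) : (m 0).eval x = 1 := by simp [m]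

theorem m_one_eval (x : ℤ) : (m 1).eval x = x := by simp [m]

theorem m_eval_zero (k : ℕ) : (m (2 * k + 1)).eval 0 = 0 := by
  induction k with
  | zero => simp [m]
  | succ k ih =>
    have h := m_rec (2 * k + 1) 0
    rw [show 2 * (k + 1) + 1 = 2 * k + 1 + 2 by ring, h, ih]
    ring

theorem m_per_one (n : ℕ) : (m (n + 3)).eval 1 = - (m n).eval 1 := by
  have h1 := m_rec n 1
  have h2 := m_rec (n + 1) 1
  simp only [add_assoc] at h1 h2
  norm_num at h1 h2
  linarith

theorem m_per_neg (n : ℕ) : (m (n + 3)).eval (-1) = (m n).eval (-1) := by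
  have h1 := m_rec n (-1)
  have h2 := m_rec (n + 1) (-1)
  simp only [add_assoc] at h1 h2
  norm_num at h1 h2
  linarith

theorem m_eval_two (n : ℕ) : (m n).eval 2 = n + 1 ∧ (m (n + 1)).eval 2 = n + 2 := by
  induction n with
  | zero => simp [m]
  | succ n ih =>
    have h := m_rec n 2
    rw [ih.1, ih.2] at h
    refine ⟨?_, ?_⟩
    · rw [ih.2]; push_cast; ring
    · rw [h]; push_cast; ring

theorem m_eval_neg_two (n : ℕ) : (m (2 * n)).eval (-2) = 2 * n + 1 ∧
    (m (2 * n + 1)).eval (-2) = - (2 * n + 2) := by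
  induction n with
  | zero => simp [m]
  | succ n ih =>
    have h := m_rec (2 * n) (-2)
    have h' := m_rec (2 * n + 1) (-2)
    rw [ih.1, ih.2] at h
    rw [show 2 * n + 1 + 1 = 2 * n + 2 from rfl, h, ih.2] at h'
    refine ⟨?_, ?_⟩
    · rw [show 2 * (n + 1) = 2 * n + 2 by ring, h]; push_cast; ring
    · rw [show 2 * (n + 1) + 1 = 2 * n + 1 + 2 by ring, h']; push_cast; ring

theorem m_six (k r : ℕ) : (m (6 * k + r)).eval 1 = (m r).eval 1 ∧
    (m (6 * k + r)).eval (-1) = (m r).eval (-1) := by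
  induction k with
  | zero => simp
  | succ k ih =>
    rw [show 6 * (k + 1) + r = 6 * k + r + 3 + 3 by ring]
    rw [m_per_one, m_per_one, m_per_neg, m_per_neg, ih.1, ih.2]
    simp

theorem f_odd (k : ℕ) : (m (2 * k + 3) - m (2 * k + 1)).eval 0 = 0 ∧
    (m (2 * k + 3) - m (2 * k + 1)).eval 2 = 2 ∧
    (m (2 * k + 3) - m (2 * k + 1)).eval (-2) = -2 := by
  have e : 2 * k + 3 = 2 * (k + 1) + 1 := by ring
  refine ⟨?_, ?_, ?_⟩
  · rw [eval_sub, e, m_eval_zero, m_eval_zero]; rfl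
  · rw [eval_sub, (m_eval_two _).1, (m_eval_two _).1]; push_cast; ring
  · rw [eval_sub, e, (m_eval_neg_two _).2, (m_eval_neg_two _).2]; push_cast; ring

/-- For `p` prime with `p > 3`, the integers `0, 1, -1, 2, -2` are roots of
`f(x) - x` where `f = m p - m (p-2)`; moreover for `p = 3` the integers
`0, 2, -2` are roots of `f(x) - x`. -/
theorem stmt_10 (p : ℕ) (hp : p.Prime) :
    (3 < p →
      (m p - m (p - 2)).eval 0 = 0 ∧
      (m p - m (p - 2)).eval 1 = 1 ∧
      (m p - m (p - 2)).eval (-1) = -1 ∧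
      (m p - m (p - 2)).eval 2 = 2 ∧
      (m p - m (p - 2)).eval (-2) = -2) ∧
    (p = 3 →
      (m p - m (p - 2)).eval 0 = 0 ∧
      (m p - m (p - 2)).eval 2 = 2 ∧
      (m p - m (p - 2)).eval (-2) = -2) := by
  have key : 3 ≤ p → (m p - m (p - 2)).eval 0 = 0 ∧
      (m p - m (p - 2)).eval 2 = 2 ∧ (m p - m (p - 2)).eval (-2) = -2 := by
    intro h3
    obtain ⟨j, hj⟩ := hp.odd_of_ne_two (by omega)
    obtain ⟨k, rfl⟩ : ∃ k, j = k + 1 := ⟨j - 1, by omega⟩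
    have h := f_odd k
    rw [show p = 2 * k + 3 by omega]
    exact h
  refine ⟨fun h3 => ?_, fun h3 => key h3.ge⟩
  obtain ⟨h0, h2, h2'⟩ := key h3.le
  have hodd := hp.odd_of_ne_two (by omega)
  have hthree : ¬ 3 ∣ p := fun hd => by
    have := (Nat.prime_dvd_prime_iff_eq Nat.prime_three hp).1 hd
    omega
  have hmod : p % 2 = 1 := Nat.odd_iff.1 hodd
  have hk : ∃ k, p = 6 * k + 5 ∨ p = 6 * k + 7 := by
    by_cases h : p % 6 = 5
    · exact ⟨p / 6, by omega⟩
    · exact ⟨p / 6 - 1, by omega⟩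
  refine ⟨h0, ?_, ?_, h2, h2'⟩
  all_goals
    obtain ⟨k, rfl | rfl⟩ := hk
    · rw [show 6 * k + 5 - 2 = 6 * k + 3 from rfl, eval_sub]
      simp only [(m_six k _).1, (m_six k _).2]
      simp [m]
    · rw [show 6 * k + 7 - 2 = 6 * k + 5 from rfl, eval_sub]
      simp only [(m_six k _).1, (m_six k _).2]
      simp [m]
end
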